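/- Let n ≥ 1 be an integer, t > 0, and let β₁, …, βₙ be real numbers. Suppose there exist real numbers M > ε > 0 such that ε ≤ βⱼ + 1 ≤ M for all j = 1, …, n. Then the iterated integral over the simplex Tₙ(t) = {(t₁,…,tₙ) : 0 < t₁ < … < tₙ < t} of ∏_{j=1}^{n} (t_{j+1} − t_j)^{βⱼ} (with t_{n+1} = t) is at most Cⁿ / Γ(|β| + n + 1) · t^{|β| + n}, where |β| = β₁ + … + βₙ and C = sup_{x ∈ [ε, M]} Γ(x). -/

import Mathlib

open MeasureTheory Real

theorem lintegral_rpow_mul_sub_rpow {a b t : ℝ} (ha : 0 < a) (hb : 0 < b) (ht : 0 < t) :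
    ∫⁻ s in Set.Ioo 0 t, ENNReal.ofReal ((t - s) ^ (b - 1) * s ^ (a - 1)) =
      ENNReal.ofReal (ProbabilityTheory.beta a b * t ^ (a + b - 1)) := by
  have hB := ProbabilityTheory.beta_pos ha hb
  have himage : (fun x => t * x) '' Set.Ioo 0 1 = Set.Ioo 0 t := by
    simp [Set.image_mul_left_Ioo ht]
  have hunit := ProbabilityTheory.lintegral_betaPDF_eq_one ha hb
  rw [ProbabilityTheory.lintegral_betaPDF] at hunit
  rw [← himage, lintegral_image_eq_lintegral_abs_deriv_mul measurableSet_Ioo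
    (fun x _ => by simpa using ((hasDerivAt_id x).const_mul t).hasDerivWithinAt)
    (mul_right_injective₀ ht.ne').injOn, ← mul_one (ENNReal.ofReal (_ * _)), ← hunit,
    ← lintegral_const_mul _ (by fun_prop)]
  refine setLIntegral_congr_fun measurableSet_Ioo fun x hx => ?_
  have hx0 : 0 < x := hx.1
  have hx1 : 0 < 1 - x := sub_pos.2 hx.2
  rw [← ENNReal.ofReal_mul (abs_nonneg _), ← ENNReal.ofReal_mul (by positivity), abs_of_pos ht,
    show t - t * x = t * (1 - x) by ring, mul_rpow ht.le hx1.le, mul_rpow ht.le hx0.le,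
    show a + b - 1 = 1 + (b - 1) + (a - 1) by ring, rpow_add ht, rpow_add ht, rpow_one]
  congr 1
  field_simp

/-- The ordered simplex `{0 < t₁ < ⋯ < tₙ < t}`. -/
def orderedSimplex (n : ℕ) (t : ℝ) : Set (Fin n → ℝ) :=
  {ts | StrictMono ts ∧ ∀ j, 0 < ts j ∧ ts j < t}

/-- The product `∏ (t_{j+1} - t_j) ^ βⱼ` of powers of consecutive gaps, with `t_{n+1} = t`. -/
noncomputable def gapProduct {n : ℕ} (β : Fin n → ℝ) (t : ℝ) (ts : Fin n → ℝ) : ℝ :=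
  ∏ j : Fin n, ((if h : (j : ℕ) + 1 < n then ts ⟨(j : ℕ) + 1, h⟩ else t) - ts j) ^ β j

theorem measurable_gapProduct {n : ℕ} (β : Fin n → ℝ) (t : ℝ) : Measurable (gapProduct β t) := by
  refine Finset.measurable_prod _ fun j _ => ?_
  split_ifs <;> fun_prop

theorem measurableSet_orderedSimplex (n : ℕ) (t : ℝ) : MeasurableSet (orderedSimplex n t) := by
  simp only [orderedSimplex, StrictMono, Set.ofPred_and, Set.ofPred_forall]
  refine .inter ?_ ?_
  · exact .iInter fun i => .iInter fun j => .iInter fun _ =>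
      measurableSet_lt (measurable_pi_apply i) (measurable_pi_apply j)
  · exact .iInter fun i => .inter (measurableSet_lt measurable_const (measurable_pi_apply i))
      (measurableSet_lt (measurable_pi_apply i) measurable_const)

theorem gapProduct_nonneg {n : ℕ} (β : Fin n → ℝ) {t : ℝ} {ts : Fin n → ℝ}
    (hts : ts ∈ orderedSimplex n t) : 0 ≤ gapProduct β t ts := by
  refine Finset.prod_nonneg fun j _ => rpow_nonneg (sub_nonneg.2 ?_) _
  split_ifs with h
  · exact (hts.1 (Fin.mk_lt_mk.2 (Nat.lt_succ_self j))).le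
  · exact (hts.2 j).2.le

theorem snoc_mem_orderedSimplex {n : ℕ} {s t : ℝ} {r : Fin n → ℝ} :
    Fin.snoc (α := fun _ => ℝ) r s ∈ orderedSimplex (n + 1) t ↔
      s ∈ Set.Ioo 0 t ∧ r ∈ orderedSimplex n s := by
  simp only [orderedSimplex, Set.mem_ofPred_eq, Fin.forall_fin_succ', Fin.snoc_castSucc,
    Fin.snoc_last, Set.mem_Ioo]
  constructor
  · rintro ⟨hmono, hr, hs⟩
    refine ⟨hs, fun i j hij => ?_, fun j => ⟨(hr j).1, ?_⟩⟩
    · simpa using hmono (Fin.castSucc_lt_castSucc_iff.2 hij)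
    · simpa using hmono (Fin.castSucc_lt_last j)
  · rintro ⟨hs, hmono, hr⟩
    refine ⟨?_, fun j => ⟨(hr j).1, (hr j).2.trans hs.2⟩, hs⟩
    intro i j hij
    induction j using Fin.lastCases with
    | last =>
      obtain ⟨i, rfl⟩ := Fin.exists_castSucc_eq.2 hij.ne
      simpa using (hr i).2
    | cast j =>
      obtain ⟨i, rfl⟩ := Fin.exists_castSucc_eq.2 (hij.trans (Fin.castSucc_lt_last j)).ne
      simpa using hmono (Fin.castSucc_lt_castSucc_iff.1 hij)

theorem gapProduct_snoc {n : ℕ} (β : Fin (n + 1) → ℝ) (s t : ℝ) (r : Fin n → ℝ) :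
    gapProduct β t (Fin.snoc (α := fun _ => ℝ) r s) =
      (t - s) ^ β (Fin.last n) * gapProduct (fun j => β j.castSucc) s r := by
  rw [gapProduct, Fin.prod_univ_castSucc, mul_comm, gapProduct]
  congr 1
  · simp
  · refine Finset.prod_congr rfl fun j _ => ?_
    have hj : (j.castSucc : ℕ) + 1 < n + 1 := Nat.succ_lt_succ j.isLt
    rw [dif_pos hj, Fin.snoc_castSucc]
    congr 2

theorem lintegral_orderedSimplex_succ {n : ℕ} (f : (Fin (n + 1) → ℝ) → ENNReal)
    (hf : Measurable f) (t : ℝ) :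
    ∫⁻ ts in orderedSimplex (n + 1) t, f ts =
      ∫⁻ s in Set.Ioo 0 t, ∫⁻ r in orderedSimplex n s, f (Fin.snoc (α := fun _ => ℝ) r s) := by
  have hS := measurableSet_orderedSimplex (n + 1) t
  let e := MeasurableEquiv.piFinSuccAbove (fun _ : Fin (n + 1) => ℝ) (Fin.last n)
  have he : MeasurePreserving e.symm :=
    (volume_preserving_piFinSuccAbove (fun _ : Fin (n + 1) => ℝ) (Fin.last n)).symm _
  have hsnoc (p : ℝ × (Fin n → ℝ)) : e.symm p = Fin.snoc (α := fun _ => ℝ) p.2 p.1 :=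
    Fin.insertNth_last' _ _
  rw [← lintegral_indicator hS, ← he.lintegral_comp (hf.indicator hS), Measure.volume_eq_prod,
    lintegral_prod (fun p => (orderedSimplex (n + 1) t).indicator f (e.symm p))
      ((hf.indicator hS).comp e.symm.measurable).aemeasurable,
    ← lintegral_indicator measurableSet_Ioo]
  refine lintegral_congr fun s => ?_
  by_cases hs : s ∈ Set.Ioo 0 t
  · rw [Set.indicator_of_mem hs, ← lintegral_indicator (measurableSet_orderedSimplex n s)]
    refine lintegral_congr fun r => ?_
    by_cases hr : r ∈ orderedSimplex n s <;>
      simp [hsnoc, Set.indicator, snoc_mem_orderedSimplex, hs.1, hs.2, hr]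
  · simp [hsnoc, Set.indicator, snoc_mem_orderedSimplex, hs]

theorem sum_add_card_add_one_pos {n : ℕ} {β : Fin n → ℝ} (hβ : ∀ j, 0 < β j + 1) :
    0 < (∑ j, β j) + n + 1 := by
  have : 0 ≤ ∑ j, (β j + 1) := Finset.sum_nonneg fun j _ => (hβ j).le
  simp only [Finset.sum_add_distrib, Finset.sum_const, Finset.card_univ, Fintype.card_fin,
    nsmul_eq_mul, mul_one] at this
  linarith

/-- Dirichlet's integral formula over the ordered simplex. -/
theorem lintegral_gapProduct {n : ℕ} (β : Fin n → ℝ) (hβ : ∀ j, 0 < β j + 1) {t : ℝ}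
    (ht : 0 < t) :
    ∫⁻ ts in orderedSimplex n t, ENNReal.ofReal (gapProduct β t ts) =
      ENNReal.ofReal ((∏ j, Gamma (β j + 1)) / Gamma ((∑ j, β j) + n + 1)
        * t ^ ((∑ j, β j) + n)) := by
  induction n generalizing t with
  | zero =>
    have : orderedSimplex 0 t = Set.univ := by
      ext ts
      simp [orderedSimplex, Subsingleton.strictMono]
    simp [this, gapProduct, volume_pi]
  | succ n ih =>
    set β' : Fin n → ℝ := fun j => β j.castSucc
    set a : ℝ := (∑ j, β' j) + n + 1
    set b : ℝ := β (Fin.last n) + 1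
    have ha : 0 < a := sum_add_card_add_one_pos fun j => hβ j.castSucc
    have hb : 0 < b := hβ _
    have hP : 0 < ∏ j, Gamma (β' j + 1) :=
      Finset.prod_pos fun j _ => Gamma_pos_of_pos (hβ j.castSucc)
    have hΓa := Gamma_pos_of_pos ha
    rw [lintegral_orderedSimplex_succ _ (measurable_gapProduct β t).ennreal_ofReal]
    calc
      _ = ∫⁻ s in Set.Ioo 0 t, ENNReal.ofReal ((∏ j, Gamma (β' j + 1)) / Gamma a) *
            ENNReal.ofReal ((t - s) ^ (b - 1) * s ^ (a - 1)) := by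
        refine setLIntegral_congr_fun measurableSet_Ioo fun s hs => ?_
        have hts : 0 ≤ (t - s) ^ β (Fin.last n) := rpow_nonneg (sub_nonneg.2 hs.2.le) _
        simp only [gapProduct_snoc, ENNReal.ofReal_mul hts]
        rw [lintegral_const_mul _ (measurable_gapProduct _ s).ennreal_ofReal,
          ih β' (fun j => hβ j.castSucc) hs.1, ← ENNReal.ofReal_mul hts,
          ← ENNReal.ofReal_mul (by positivity), show b - 1 = β (Fin.last n) by simp [b],
          show a - 1 = (∑ j, β' j) + n by simp [a]]
        congr 1
        ring
      _ = _ := by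
        rw [lintegral_const_mul _ (by fun_prop), lintegral_rpow_mul_sub_rpow ha hb ht,
          ← ENNReal.ofReal_mul (by positivity), Fin.prod_univ_castSucc, Fin.sum_univ_castSucc,
          ProbabilityTheory.beta]
        have hexp : (∑ j : Fin n, β j.castSucc) + β (Fin.last n) + ((n + 1 : ℕ) : ℝ) =
            a + b - 1 := by
          push_cast
          simp only [a, b, β']
          ring
        rw [hexp, sub_add_cancel]
        congr 1
        field_simp
        rfl

theorem Gamma_le_sSup_image_Icc {ε M x : ℝ} (hε : 0 < ε) (hx : x ∈ Set.Icc ε M) :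
    Gamma x ≤ sSup (Gamma '' Set.Icc ε M) := by
  have hcont : ContinuousOn Gamma (Set.Icc ε M) :=
    differentiableOn_Gamma_Ioi.continuousOn.mono fun y hy => hε.trans_le hy.1
  exact le_csSup (isCompact_Icc.bddAbove_image hcont) (Set.mem_image_of_mem _ hx)

/-- If `ε ≤ βⱼ + 1 ≤ M` with `0 < ε < M`, then the iterated integral over the simplex
`Tₙ(t)` of `∏_{j=1}^{n} (t_{j+1} − t_j)^{βⱼ}` (with `t_{n+1} = t`) is at most
`Cⁿ / Γ(|β|+n+1) · t^{|β|+n}` where `C = sup_{x ∈ [ε,M]} Γ(x)`. -/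
theorem simplex_integral_le (n : ℕ) (hn : 1 ≤ n) (t : ℝ) (ht : 0 < t)
    (β : Fin n → ℝ) (ε M : ℝ) (hε : 0 < ε) (hεM : ε < M)
    (hβ : ∀ j, ε ≤ β j + 1 ∧ β j + 1 ≤ M) :
    (∫ ts in {ts : Fin n → ℝ | StrictMono ts ∧ ∀ j, 0 < ts j ∧ ts j < t},
        ∏ j : Fin n,
          ((if h : (j : ℕ) + 1 < n then ts ⟨(j : ℕ) + 1, h⟩ else t) - ts j) ^ (β j))
      ≤ (sSup (Real.Gamma '' Set.Icc ε M)) ^ n / Real.Gamma ((∑ j, β j) + n + 1)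
          * t ^ ((∑ j, β j) + n) := by
  have hpos : ∀ j, 0 < β j + 1 := fun j => hε.trans_le (hβ j).1
  have hΓ := Gamma_pos_of_pos (sum_add_card_add_one_pos hpos)
  have hprod : 0 ≤ ∏ j, Gamma (β j + 1) :=
    Finset.prod_nonneg fun j _ => (Gamma_pos_of_pos (hpos j)).le
  calc
    _ = ∫ ts in orderedSimplex n t, gapProduct β t ts := rfl
    _ = (∏ j, Gamma (β j + 1)) / Gamma ((∑ j, β j) + n + 1) * t ^ ((∑ j, β j) + n) := by
      rw [integral_eq_lintegral_of_nonneg_ae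
        (ae_restrict_of_forall_mem (measurableSet_orderedSimplex n t)
          fun ts hts => gapProduct_nonneg β hts)
        (measurable_gapProduct β t).aestronglyMeasurable, lintegral_gapProduct β hpos ht,
        ENNReal.toReal_ofReal (by positivity)]
    _ ≤ _ := by
      gcongr
      calc
        _ ≤ ∏ _j : Fin n, sSup (Gamma '' Set.Icc ε M) :=
          Finset.prod_le_prod (fun j _ => (Gamma_pos_of_pos (hpos j)).le)
            fun j _ => Gamma_le_sSup_image_Icc hε (hβ j)
        _ = _ := by simp
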